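/- arXiv:2505.07244 — 4 statements merged into one kernel-verified Lean document; each statement's English description precedes it below -/
import Mathlib

section
/- Let X ⊆ ℝⁿ be open, k ≥ 0, Ψ ∈ C^k(X, ℝⁿ) and T > 0. For every x ∈ X, the function y : [−T, T] → ℝⁿ defined by y(t) = x for t ∈ [−T,0] and y(t) = x + (t/T)(Ψ(x) − x) for t ∈ [0,T] is the unique solution on [0,T] of the delay differential equation y′(t) = (1/T)(Ψ(y(t−T)) − y(t−T)) for t ∈ [0,T] with constant initial data y(t) = x on [−T,0]; in particular y(T) = Ψ(x). Consequently, every map Ψ ∈ C^k(X, ℝⁿ) is exactly represented (embedded) as the time-T solution map of a DDE with delay τ = T and constant initial data, i.e. by a basic non-augmented neural DDE with identity affine layers. -/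
open Set

noncomputable section

/-- For `Ψ ∈ C^k(X, ℝⁿ)`, `X ⊆ ℝⁿ` open, `T > 0` and every `x ∈ X`, the
function `y(t) = x` on `[-T,0]`, `y(t) = x + (t/T)(Ψ(x) - x)` on `[0,T]` is the unique solution
on `[0,T]` of the DDE `y'(t) = (1/T)(Ψ(y(t-T)) - y(t-T))` with constant initial data `x`;
in particular `y(T) = Ψ(x)`, so `Ψ` is embedded by a basic neural DDE with delay `τ = T`. -/
theorem basic_neuralDDE_embedding_tau_eq_T
    {n : ℕ} (k : ℕ) (X : Set (Fin n → ℝ)) (hX : IsOpen X)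
    (Ψ : (Fin n → ℝ) → Fin n → ℝ) (hΨ : ContDiffOn ℝ k Ψ X)
    (T : ℝ) (hT : 0 < T) :
    ∀ x ∈ X,
      ∃ y : ℝ → Fin n → ℝ,
        (∀ t : ℝ, y t = if t ≤ 0 then x else x + (t / T) • (Ψ x - x)) ∧
        Continuous y ∧
        (∀ s ∈ Icc (-T) (0 : ℝ), y s = x) ∧
        (∀ t ∈ Icc (0 : ℝ) T,
          HasDerivWithinAt y ((1 / T) • (Ψ (y (t - T)) - y (t - T))) (Icc (0 : ℝ) T) t) ∧
        y T = Ψ x ∧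
        (∀ z : ℝ → Fin n → ℝ, Continuous z →
          (∀ s ∈ Icc (-T) (0 : ℝ), z s = x) →
          (∀ t ∈ Icc (0 : ℝ) T,
            HasDerivWithinAt z ((1 / T) • (Ψ (z (t - T)) - z (t - T))) (Icc (0 : ℝ) T) t) →
          ∀ t ∈ Icc (-T) T, z t = y t) := by
  intro x _
  let y : ℝ → Fin n → ℝ := fun t ↦ if t ≤ 0 then x else x + (t / T) • (Ψ x - x)
  have hy_nonpos : ∀ t ≤ 0, y t = x := fun t ht ↦ if_pos ht
  have hy_nonneg : ∀ t, 0 ≤ t → y t = x + (t / T) • (Ψ x - x) := by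
    intro t ht
    rcases ht.eq_or_lt with rfl | ht
    · simp [y]
    · exact if_neg ht.not_ge
  have hy_deriv : ∀ t ∈ Icc (0 : ℝ) T,
      HasDerivWithinAt y ((1 / T) • (Ψ x - x)) (Icc (0 : ℝ) T) t := by
    intro t ht
    have h : HasDerivAt (fun t : ℝ ↦ x + (t / T) • (Ψ x - x)) ((1 / T) • (Ψ x - x)) t :=
      (((hasDerivAt_id t).div_const T).smul_const (Ψ x - x)).const_add x
    exact h.hasDerivWithinAt.congr (fun s hs ↦ hy_nonneg s hs.1) (hy_nonneg t ht.1)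
  refine ⟨y, fun _ ↦ rfl, ?_, fun s hs ↦ hy_nonpos s hs.2, ?_, ?_, ?_⟩
  · refine Continuous.if_le (by fun_prop) (by fun_prop) (by fun_prop) (by fun_prop) ?_
    rintro t rfl
    simp
  · intro t ht
    rw [hy_nonpos (t - T) (sub_nonpos.2 ht.2)]
    exact hy_deriv t ht
  · rw [hy_nonneg T hT.le, div_self hT.ne', one_smul, add_sub_cancel]
  · intro z _ hz_init hz_deriv t ht
    have hz : ∀ t ∈ Icc (0 : ℝ) T,
        HasDerivWithinAt z ((1 / T) • (Ψ x - x)) (Icc (0 : ℝ) T) t := by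
      intro t ht
      have h := hz_deriv t ht
      rwa [hz_init (t - T) ⟨by linarith [ht.1], sub_nonpos.2 ht.2⟩] at h
    rcases le_total t 0 with h0 | h0
    · rw [hz_init t ⟨ht.1, h0⟩, hy_nonpos t h0]
    · refine eq_of_derivWithin_eq (fun s hs ↦ (hz s hs).differentiableWithinAt)
        (fun s hs ↦ (hy_deriv s hs).differentiableWithinAt) (fun s hs ↦ ?_) ?_ t ⟨h0, ht.2⟩
      · have hs' := Ico_subset_Icc_self hs
        have hu := uniqueDiffOn_Icc hT s hs'
        rw [(hz s hs').derivWithin hu, (hy_deriv s hs').derivWithin hu]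
      · rw [hz_init 0 ⟨by linarith, le_rfl⟩, hy_nonpos 0 le_rfl]
end
end

section
/- Let τ ≥ 0 and let F : ℝ × 𝒞 → ℝᵐ be weakly nonlinear with constants K > 0 and A ≥ 0. Then for each initial time t₀ ∈ ℝ and each initial function u ∈ 𝒞, there exists a unique continuous, globally defined solution y(t₀,u) : [t₀ − τ, ∞) → ℝᵐ of the DDE y′(t) = F(t, y_t) with y_{t₀} = u. Moreover, for all u, v ∈ 𝒞 and all t ≥ t₀: (a) ‖y(t₀,u)(t)‖∞ ≤ ‖u‖∞·e^{K(t−t₀)} + (A/K)·(e^{K(t−t₀)} − 1), and (b) ‖y(t₀,u)(t) − y(t₀,v)(t)‖∞ ≤ ‖u − v‖∞·e^{K(t−t₀)}. -/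
open Set

noncomputable section

/-- The history space `𝒞 = C([-τ,0], ℝᵐ)` with the sup norm; `ℝᵐ` carries the max norm. -/
abbrev Hist (τ : ℝ) (m : ℕ) : Type := C(Set.Icc (-τ) (0:ℝ), Fin m → ℝ)

/-- The constant history function `c_v ∈ 𝒞`. -/
def histConst {m : ℕ} (τ : ℝ) (v : Fin m → ℝ) : Hist τ m := ContinuousMap.const _ v

-- The history segment `y_t ∈ 𝒞`, defined by `y_t(s) = y(t+s)` for `s ∈ [-τ,0]`
-- (junk value if `y` is not continuous).
open Classical in
def seg {m : ℕ} (τ : ℝ) (y : ℝ → Fin m → ℝ) (t : ℝ) : Hist τ m :=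
  if hy : Continuous y then
    ⟨fun s => y (t + s.1), hy.comp (continuous_const.add continuous_subtype_val)⟩
  else 0

/-- Operator norm of a matrix, induced by the maximum norms. -/
def opNormMax {m n : ℕ} (W : Matrix (Fin m) (Fin n) ℝ) : ℝ :=
  ‖LinearMap.toContinuousLinearMap W.mulVecLin‖

/-- `y` is a (continuous) solution on `[0,T]` of the DDE `y'(t) = F(t, y_t)` with constant
initial data `y ≡ v` on `[-τ,0]` (one-sided derivatives at the endpoints of `[0,T]`). -/
def IsSolOn {m : ℕ} (τ T : ℝ) (F : ℝ → Hist τ m → Fin m → ℝ)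
    (v : Fin m → ℝ) (y : ℝ → Fin m → ℝ) : Prop :=
  Continuous y ∧ (∀ s ∈ Set.Icc (-τ) (0:ℝ), y s = v) ∧
    ∀ t ∈ Set.Icc (0:ℝ) T, HasDerivWithinAt y (F t (seg τ y t)) (Set.Icc (0:ℝ) T) t

/-- `F` is weakly nonlinear with constants `K`, `A`: continuous, `‖F(t,0)‖ ≤ A`, and globally
Lipschitz in the second variable with constant `K`. -/
def WeaklyNonlinear {m : ℕ} (τ : ℝ) (F : ℝ → Hist τ m → Fin m → ℝ) (K A : ℝ) : Prop :=
  Continuous (fun p : ℝ × Hist τ m => F p.1 p.2) ∧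
    (∀ t : ℝ, ‖F t 0‖ ≤ A) ∧
    ∀ (t : ℝ) (u v : Hist τ m), ‖F t u - F t v‖ ≤ K * ‖u - v‖

/-- `y` is a continuous solution of the DDE `y'(t) = F(t, y_t)` on `[t₀ - τ, ∞)` with initial
data `y(t₀ + s) = u(s)` for `s ∈ [-τ, 0]`. -/
def IsGlobalSol {m : ℕ} (τ : ℝ) (F : ℝ → Hist τ m → Fin m → ℝ)
    (t₀ : ℝ) (u : Hist τ m) (y : ℝ → Fin m → ℝ) : Prop :=
  Continuous y ∧ (∀ s : Set.Icc (-τ) (0:ℝ), y (t₀ + s.1) = u s) ∧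
    ∀ t ∈ Set.Ici t₀, HasDerivWithinAt y (F t (seg τ y t)) (Set.Ici t₀) t

/-- A special solution of the DDE `y'(t) = F(t, y_t)`: a (continuously differentiable) solution
defined on all of `ℝ` satisfying the growth condition `sup_t e^{-|t|/τ} ‖y(t)‖ < ∞`. -/
def IsSpecialSol {m : ℕ} (τ : ℝ) (F : ℝ → Hist τ m → Fin m → ℝ) (y : ℝ → Fin m → ℝ) : Prop :=
  Continuous y ∧ (∀ t : ℝ, HasDerivAt y (F t (seg τ y t)) t) ∧
    ∃ C : ℝ, ∀ t : ℝ, Real.exp (-|t| / τ) * ‖y t‖ ≤ C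

open scoped BoundedContinuousFunction NNReal

section Segments

variable {m : ℕ} {τ : ℝ} {y z : ℝ → Fin m → ℝ}

lemma seg_apply (hy : Continuous y) (t : ℝ) (s : Set.Icc (-τ) (0:ℝ)) :
    seg τ y t s = y (t + s.1) := by
  simp [seg, hy]

lemma continuous_seg (hy : Continuous y) : Continuous (seg τ y) := by
  refine ContinuousMap.continuous_of_continuous_uncurry _ ?_
  have h : (Function.uncurry fun t s => seg τ y t s) =
      fun p : ℝ × Set.Icc (-τ) (0:ℝ) => y (p.1 + p.2.1) := by
    ext1 p
    exact seg_apply hy p.1 p.2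
  rw [h]
  fun_prop

lemma seg_sub (hy : Continuous y) (hz : Continuous z) (t : ℝ) :
    seg τ (fun s => y s - z s) t = seg τ y t - seg τ z t := by
  ext1 s
  have hyz : Continuous fun s => y s - z s := hy.sub hz
  rw [ContinuousMap.sub_apply, seg_apply hyz, seg_apply hy, seg_apply hz]

/-- Grönwall's inequality for delay differential inequalities. -/
lemma norm_le_gronwallBound_of_norm_deriv_le_seg (hτ : 0 ≤ τ) {K A δ t₀ : ℝ} (hK : 0 ≤ K)
    (hA : 0 ≤ A) {y' : ℝ → Fin m → ℝ} (hy : Continuous y)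
    (hinit : ∀ s ∈ Set.Icc (-τ) (0:ℝ), ‖y (t₀ + s)‖ ≤ δ)
    (hderiv : ∀ t ∈ Set.Ici t₀, HasDerivWithinAt y (y' t) (Set.Ici t₀) t)
    (hbound : ∀ t ∈ Set.Ici t₀, ‖y' t‖ ≤ K * ‖seg τ y t‖ + A) {t : ℝ} (ht : t₀ ≤ t) :
    ‖y t‖ ≤ gronwallBound δ K A (t - t₀) := by
  have hδ₀ : ‖y t₀‖ ≤ δ := by simpa using hinit 0 ⟨by linarith, le_rfl⟩
  have hδ : 0 ≤ δ := (norm_nonneg _).trans hδ₀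
  set g : ℝ → ℝ := fun s => K * ‖seg τ y s‖ + A with hg
  have hgc : Continuous g := ((continuous_seg hy).norm.const_mul K).add_const A
  have hg0 : ∀ s, 0 ≤ g s := fun s => by positivity
  set G : ℝ → ℝ := fun r => δ + ∫ s in t₀..r, g s with hG
  have hGd : ∀ r, HasDerivAt G (g r) r := fun r =>
    (hgc.integral_hasStrictDerivAt t₀ r).hasDerivAt.const_add δ
  have hGmono : Monotone G :=
    monotone_of_hasDerivAt_nonneg hGd hg0
  have hG₀ : G t₀ = δ := by simp [hG]
  have hyG : ∀ r, t₀ ≤ r → ‖y r‖ ≤ G r := fun r hr =>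
    image_norm_le_of_norm_deriv_right_le_deriv_boundary hy.continuousOn
      (fun x hx => (hderiv x hx.1).mono (Set.Ici_subset_Ici.2 hx.1)) (hδ₀.trans_eq hG₀.symm) hGd
      (fun x hx => hbound x hx.1) (Set.right_mem_Icc.2 hr)
  have hseg : ∀ r, t₀ ≤ r → ‖seg τ y r‖ ≤ G r := fun r hr => by
    have hδG : δ ≤ G r := hG₀.symm.trans_le (hGmono hr)
    refine (ContinuousMap.norm_le _ (hδ.trans hδG)).2 fun s => ?_
    rw [seg_apply hy]
    rcases le_total t₀ (r + s.1) with h | h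
    · exact (hyG _ h).trans (hGmono (by linarith [s.2.2]))
    · have := hinit (r + s.1 - t₀) ⟨by linarith [s.2.1], by linarith⟩
      rw [add_sub_cancel] at this
      exact this.trans hδG
  have hG0 : ∀ r, t₀ ≤ r → 0 ≤ G r := fun r hr => (norm_nonneg _).trans (hyG r hr)
  have := norm_le_gronwallBound_of_norm_deriv_right_le (f := G) (f' := g) (δ := δ) (K := K)
    (ε := A) (a := t₀) (b := t) (fun x _ => (hGd x).continuousAt.continuousWithinAt)
    (fun x _ => (hGd x).hasDerivWithinAt) (by rw [hG₀, Real.norm_of_nonneg hδ])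
    (fun x hx => by
      rw [Real.norm_of_nonneg (hg0 x), Real.norm_of_nonneg (hG0 x hx.1)]
      have := hseg x hx.1
      simp only [hg]
      gcongr) t (Set.right_mem_Icc.2 ht)
  exact (hyG t ht).trans ((le_abs_self _).trans this)

end Segments

section WeightedPicard

variable {E : Type*} [NormedAddCommGroup E] [NormedSpace ℝ E]

/-- The weight `exp (c (t - t₀)⁺)`. -/
def expWeight (c t₀ t : ℝ) : ℝ := Real.exp (c * (max t t₀ - t₀))

lemma expWeight_pos (c t₀ t : ℝ) : 0 < expWeight c t₀ t := Real.exp_pos _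

lemma one_le_expWeight {c : ℝ} (hc : 0 ≤ c) (t₀ t : ℝ) : 1 ≤ expWeight c t₀ t :=
  Real.one_le_exp (mul_nonneg hc (sub_nonneg.2 (le_max_right _ _)))

lemma continuous_expWeight (c t₀ : ℝ) : Continuous (expWeight c t₀) := by
  unfold expWeight
  fun_prop

lemma expWeight_mono {c : ℝ} (hc : 0 ≤ c) (t₀ : ℝ) : Monotone (expWeight c t₀) := by
  intro s t hst
  unfold expWeight
  gcongr

lemma norm_integral_le_expWeight {c C t₀ : ℝ} (hc : 0 < c) (hC : 0 ≤ C) {f : ℝ → E}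
    (hf : ∀ t, t₀ ≤ t → ‖f t‖ ≤ C * expWeight c t₀ t) (t : ℝ) :
    ‖∫ s in t₀..max t t₀, f s‖ ≤ C / c * expWeight c t₀ t := by
  have hle : t₀ ≤ max t t₀ := le_max_right _ _
  have hd : ∀ x, HasDerivAt (fun s => C / c * Real.exp (c * (s - t₀)))
      (C * Real.exp (c * (x - t₀))) x := fun x => by
    convert! (((((hasDerivAt_id x).sub_const t₀).const_mul c).exp).const_mul (C / c)) using 1
    simp only [id]
    field_simp
  have hint : ∫ s in t₀..max t t₀, C * Real.exp (c * (s - t₀)) =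
      C / c * Real.exp (c * (max t t₀ - t₀)) - C / c * Real.exp (c * (t₀ - t₀)) :=
    intervalIntegral.integral_eq_sub_of_hasDerivAt (fun x _ => hd x)
      ((by fun_prop : Continuous fun s => C * Real.exp (c * (s - t₀))).intervalIntegrable _ _)
  have hnorm : ‖∫ s in t₀..max t t₀, f s‖ ≤
      ∫ s in t₀..max t t₀, C * Real.exp (c * (s - t₀)) := by
    refine intervalIntegral.norm_integral_le_of_norm_le hle (Filter.Eventually.of_forall ?_)
      ((by fun_prop : Continuous fun s => C * Real.exp (c * (s - t₀))).intervalIntegrable _ _)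
    intro s hs
    have := hf s hs.1.le
    rwa [expWeight, max_eq_left hs.1.le] at this
  rw [hint] at hnorm
  refine hnorm.trans (sub_le_self _ (by positivity))

/-- Picard iteration in an exponentially weighted space: an integral equation on `[t₀, ∞)` with a
globally Lipschitz right-hand side of exponential growth has a solution. -/
lemma exists_expWeight_smul_eq_integral [CompleteSpace E] {K t₀ : ℝ} (hK : 0 < K)
    (G : (ℝ →ᵇ E) → ℝ → E) (hcont : ∀ w, Continuous (G w))
    (hbdd : ∀ w, ∃ C, 0 ≤ C ∧ ∀ t, t₀ ≤ t → ‖G w t‖ ≤ C * expWeight (2 * K) t₀ t)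
    (hlip : ∀ w w' t, t₀ ≤ t → ‖G w t - G w' t‖ ≤ K * ‖w - w'‖ * expWeight (2 * K) t₀ t) :
    ∃ w : ℝ →ᵇ E, ∀ t, expWeight (2 * K) t₀ t • w t = ∫ s in t₀..max t t₀, G w s := by
  have h2K : 0 < 2 * K := by positivity
  have key : ∀ {x : E} {C : ℝ} (t : ℝ), ‖x‖ ≤ C * expWeight (2 * K) t₀ t →
      ‖(expWeight (2 * K) t₀ t)⁻¹ • x‖ ≤ C := fun {x C} t hx => by
    have hp := expWeight_pos (2 * K) t₀ t
    rw [norm_smul, norm_inv, Real.norm_of_nonneg hp.le, inv_mul_le_iff₀ hp, mul_comm]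
    exact hx
  have hTc : ∀ w, Continuous fun t =>
      (expWeight (2 * K) t₀ t)⁻¹ • ∫ s in t₀..max t t₀, G w s := fun w => by
    refine ((continuous_expWeight _ _).inv₀ fun t => (expWeight_pos _ _ t).ne').smul ?_
    exact (intervalIntegral.continuous_primitive
      (fun a b => (hcont w).intervalIntegrable a b) t₀).comp (continuous_id.max continuous_const)
  have hTb : ∀ w, ∃ C, ∀ t,
      ‖(expWeight (2 * K) t₀ t)⁻¹ • ∫ s in t₀..max t t₀, G w s‖ ≤ C := fun w => by
    obtain ⟨C, hC, h⟩ := hbdd w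
    exact ⟨C / (2 * K), fun t => key t (norm_integral_le_expWeight h2K hC h t)⟩
  choose C hTC using hTb
  set T : (ℝ →ᵇ E) → (ℝ →ᵇ E) := fun w =>
    BoundedContinuousFunction.ofNormedAddCommGroup _ (hTc w) (C w) (hTC w)
  have hcontr : ContractingWith (1 / 2 : ℝ≥0) T := by
    refine ⟨by rw [← NNReal.coe_lt_coe]; norm_num, LipschitzWith.of_dist_le_mul fun w w' => ?_⟩
    rw [dist_eq_norm, dist_eq_norm]
    refine (BoundedContinuousFunction.norm_le (by positivity)).2 fun t => ?_
    have hsub : (T w - T w') t = (expWeight (2 * K) t₀ t)⁻¹ •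
        ∫ s in t₀..max t t₀, (G w s - G w' s) := by
      rw [intervalIntegral.integral_sub ((hcont w).intervalIntegrable _ _)
        ((hcont w').intervalIntegrable _ _), smul_sub]
      rfl
    rw [hsub]
    refine (key t (norm_integral_le_expWeight h2K (by positivity) (hlip w w') t)).trans_eq ?_
    push_cast
    field_simp
  refine ⟨ContractingWith.fixedPoint T hcontr, fun t => ?_⟩
  have h : T _ t = _ := DFunLike.congr_fun hcontr.fixedPoint_isFixedPt t
  rw [← h]
  exact smul_inv_smul₀ (expWeight_pos _ _ t).ne' _

end WeightedPicard

section DelayEquation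

variable {m : ℕ} {τ K A : ℝ} {F : ℝ → Hist τ m → Fin m → ℝ} {t₀ : ℝ}

lemma WeaklyNonlinear.continuous_comp_seg (hF : WeaklyNonlinear τ F K A) {y : ℝ → Fin m → ℝ}
    (hy : Continuous y) : Continuous fun t => F t (seg τ y t) :=
  hF.1.comp (continuous_id.prodMk (continuous_seg hy))

lemma WeaklyNonlinear.norm_le (hF : WeaklyNonlinear τ F K A) (t : ℝ) (u : Hist τ m) :
    ‖F t u‖ ≤ K * ‖u‖ + A := by
  have h := hF.2.2 t u 0
  rw [sub_zero] at h
  linarith [norm_le_norm_add_norm_sub' (F t u) (F t 0), hF.2.1 t]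

lemma exists_isGlobalSol (hτ : 0 ≤ τ) (hK : 0 < K) (hA : 0 ≤ A) (hF : WeaklyNonlinear τ F K A)
    (u : Hist τ m) : ∃ y, IsGlobalSol τ F t₀ u y := by
  have hτ' : -τ ≤ 0 := by linarith
  set b : ℝ → Fin m → ℝ := fun t => Set.IccExtend hτ' u (t - t₀) with hb
  have hbc : Continuous b := u.continuous.Icc_extend'.comp (continuous_id.sub continuous_const)
  have hbu : ∀ t, ‖b t‖ ≤ ‖u‖ := fun t => u.norm_coe_le_norm _
  set Y : (ℝ →ᵇ (Fin m → ℝ)) → ℝ → Fin m → ℝ := fun w t => b t + expWeight (2 * K) t₀ t • w t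
    with hY
  have hYc : ∀ w, Continuous (Y w) := fun w =>
    hbc.add ((continuous_expWeight _ _).smul w.continuous)
  have hmono : ∀ t (s : Set.Icc (-τ) (0:ℝ)),
      expWeight (2 * K) t₀ (t + s.1) ≤ expWeight (2 * K) t₀ t := fun t s =>
    expWeight_mono (by positivity) t₀ (by linarith [s.2.2])
  have hYnorm : ∀ w t, ‖seg τ (Y w) t‖ ≤ (‖u‖ + ‖w‖) * expWeight (2 * K) t₀ t := fun w t => by
    have hp := expWeight_pos (2 * K) t₀ t
    refine (ContinuousMap.norm_le _ (by positivity)).2 fun s => ?_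
    rw [seg_apply (hYc w), add_mul]
    refine (norm_add_le _ _).trans (add_le_add ?_ ?_)
    · exact (hbu _).trans (le_mul_of_one_le_right (norm_nonneg _)
        (one_le_expWeight (by positivity) _ _))
    · rw [norm_smul, Real.norm_of_nonneg (expWeight_pos _ _ _).le, mul_comm]
      exact mul_le_mul (w.norm_coe_le_norm _) (hmono t s) (expWeight_pos _ _ _).le (norm_nonneg _)
  have hYsub : ∀ w w' t, ‖seg τ (Y w) t - seg τ (Y w') t‖ ≤
      ‖w - w'‖ * expWeight (2 * K) t₀ t := fun w w' t => by
    have hp := expWeight_pos (2 * K) t₀ t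
    refine (ContinuousMap.norm_le _ (by positivity)).2 fun s => ?_
    rw [ContinuousMap.sub_apply, seg_apply (hYc w), seg_apply (hYc w')]
    simp only [hY]
    rw [add_sub_add_left_eq_sub, ← smul_sub, norm_smul,
      Real.norm_of_nonneg (expWeight_pos _ _ _).le, mul_comm]
    exact mul_le_mul ((w - w').norm_coe_le_norm _) (hmono t s) (expWeight_pos _ _ _).le
      (norm_nonneg _)
  obtain ⟨w, hw⟩ := exists_expWeight_smul_eq_integral (t₀ := t₀) hK
    (fun w t => F t (seg τ (Y w) t)) (fun w => hF.continuous_comp_seg (hYc w))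
    (fun w => ⟨K * (‖u‖ + ‖w‖) + A, by positivity, fun t _ => by
      have h1 := one_le_expWeight (c := 2 * K) (by positivity) t₀ t
      have h2 := mul_le_mul_of_nonneg_left (hYnorm w t) hK.le
      have h3 := le_mul_of_one_le_right hA h1
      linarith [hF.norm_le t (seg τ (Y w) t)]⟩)
    (fun w w' t _ => (hF.2.2 t _ _).trans (by
      rw [mul_assoc]
      exact mul_le_mul_of_nonneg_left (hYsub w w' t) hK.le))
  have hYw : ∀ t, Y w t = b t + ∫ s in t₀..max t t₀, F s (seg τ (Y w) s) := fun t => by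
    rw [← hw t]
  refine ⟨Y w, hYc w, fun s => ?_, fun t ht => ?_⟩
  · rw [hYw, max_eq_right (by linarith [s.2.2]), intervalIntegral.integral_same, add_zero]
    simp only [hb, add_sub_cancel_left]
    exact Set.IccExtend_val hτ' u s
  · have hcongr : ∀ r ∈ Set.Ici t₀,
        Y w r = b t₀ + ∫ s in t₀..r, F s (seg τ (Y w) s) := fun r hr => by
      have hr' : t₀ ≤ r := hr
      rw [hYw, max_eq_left hr']
      simp only [hb]
      rw [Set.IccExtend_of_right_le _ _ (sub_nonneg.2 hr'), sub_self,
        Set.IccExtend_of_right_le _ _ le_rfl]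
    exact ((((hF.continuous_comp_seg (hYc w)).integral_hasStrictDerivAt t₀ t).hasDerivAt.const_add
      (b t₀)).hasDerivWithinAt).congr hcongr (hcongr t ht)

lemma IsGlobalSol.norm_le (hτ : 0 ≤ τ) (hK : 0 < K) (hA : 0 ≤ A) (hF : WeaklyNonlinear τ F K A)
    {u : Hist τ m} {y : ℝ → Fin m → ℝ} (hy : IsGlobalSol τ F t₀ u y) {t : ℝ} (ht : t₀ ≤ t) :
    ‖y t‖ ≤ ‖u‖ * Real.exp (K * (t - t₀)) + (A / K) * (Real.exp (K * (t - t₀)) - 1) := by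
  have h := norm_le_gronwallBound_of_norm_deriv_le_seg (δ := ‖u‖) hτ hK.le hA hy.1
    (fun s hs => (congrArg norm (hy.2.1 ⟨s, hs⟩)).trans_le (u.norm_coe_le_norm _)) hy.2.2
    (fun t _ => hF.norm_le t _) ht
  rwa [gronwallBound_of_K_ne_0 hK.ne'] at h

lemma IsGlobalSol.norm_sub_le (hτ : 0 ≤ τ) (hK : 0 ≤ K) (hF : WeaklyNonlinear τ F K A)
    {u v : Hist τ m} {y z : ℝ → Fin m → ℝ} (hy : IsGlobalSol τ F t₀ u y)
    (hz : IsGlobalSol τ F t₀ v z) {t : ℝ} (ht : t₀ ≤ t) :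
    ‖y t - z t‖ ≤ ‖u - v‖ * Real.exp (K * (t - t₀)) := by
  rw [← gronwallBound_ε0]
  refine norm_le_gronwallBound_of_norm_deriv_le_seg (y := fun s => y s - z s) hτ hK le_rfl
    (hy.1.sub hz.1) (fun s hs => ?_) (fun t ht => (hy.2.2 t ht).sub (hz.2.2 t ht))
    (fun t _ => ?_) ht
  · have h := (u - v).norm_coe_le_norm ⟨s, hs⟩
    rwa [ContinuousMap.sub_apply, ← hy.2.1 ⟨s, hs⟩, ← hz.2.1 ⟨s, hs⟩] at h
  · rw [seg_sub hy.1 hz.1, add_zero]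
    exact hF.2.2 t _ _

lemma IsGlobalSol.eqOn (hτ : 0 ≤ τ) (hK : 0 ≤ K) (hF : WeaklyNonlinear τ F K A)
    {u : Hist τ m} {y z : ℝ → Fin m → ℝ} (hy : IsGlobalSol τ F t₀ u y)
    (hz : IsGlobalSol τ F t₀ u z) : Set.EqOn y z (Set.Ici (t₀ - τ)) := by
  intro t ht
  rcases le_total t₀ t with h | h
  · have := hy.norm_sub_le hτ hK hF hz h
    rw [sub_self, norm_zero, zero_mul] at this
    exact sub_eq_zero.1 (norm_le_zero_iff.1 this)
  · have hs : t - t₀ ∈ Set.Icc (-τ) (0:ℝ) := ⟨by linarith [Set.mem_Ici.1 ht], by linarith⟩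
    have hyt := hy.2.1 ⟨_, hs⟩
    have hzt := hz.2.1 ⟨_, hs⟩
    rw [add_sub_cancel] at hyt hzt
    rw [hyt, hzt]

end DelayEquation

/-- Global existence, uniqueness and a priori estimates for DDEs with
weakly nonlinear vector fields: every initial data `(t₀, u)` determines a unique continuous
global solution on `[t₀-τ, ∞)`, and the stated exponential bounds (a), (b) hold. -/
theorem global_existence_weakly_nonlinear
    {m : ℕ} (τ : ℝ) (hτ : 0 ≤ τ) (F : ℝ → Hist τ m → Fin m → ℝ)
    (K A : ℝ) (hK : 0 < K) (hA : 0 ≤ A) (hF : WeaklyNonlinear τ F K A)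
    (t₀ : ℝ) (u : Hist τ m) :
    ∃ y : ℝ → Fin m → ℝ,
      IsGlobalSol τ F t₀ u y ∧
      (∀ z : ℝ → Fin m → ℝ, IsGlobalSol τ F t₀ u z → Set.EqOn z y (Set.Ici (t₀ - τ))) ∧
      (∀ t : ℝ, t₀ ≤ t →
        ‖y t‖ ≤ ‖u‖ * Real.exp (K * (t - t₀)) + (A / K) * (Real.exp (K * (t - t₀)) - 1)) ∧
      (∀ (v : Hist τ m) (z : ℝ → Fin m → ℝ), IsGlobalSol τ F t₀ v z →
        ∀ t : ℝ, t₀ ≤ t → ‖y t - z t‖ ≤ ‖u - v‖ * Real.exp (K * (t - t₀))) := by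
  obtain ⟨y, hy⟩ := exists_isGlobalSol (t₀ := t₀) hτ hK hA hF u
  exact ⟨y, hy, fun z hz => hz.eqOn hτ hK.le hF hy, fun t ht => hy.norm_le hτ hK hA hF ht,
    fun v z hz t ht => hy.norm_sub_le hτ hK.le hF hz ht⟩
end
end

section
/- Let τ > 0, K > 0 with K·τ·e < 1. Then the characteristic equation λ = −K·e^{−λτ} has a unique solution λ₁ with −1/τ < λ₁ < 0, and this solution satisfies K < |λ₁| < K·e. Moreover, if F : ℝ × 𝒞 → ℝᵐ is weakly nonlinear with constants K > 0, A ≥ 0, then for all t₀ ∈ ℝ and y₀, z₀ ∈ ℝᵐ, the unique special solutions ȳ(t₀,y₀) and ȳ(t₀,z₀) of the DDE y′(t) = F(t, y_t) satisfy ‖ȳ(t₀,y₀)(t) − ȳ(t₀,z₀)(t)‖∞ ≤ ‖y₀ − z₀‖∞·e^{|λ₁|(t₀−t)} for all t ≤ t₀, and ‖ȳ(t₀,y₀)(t) − ȳ(t₀,z₀)(t)‖∞ ≤ ‖y₀ − z₀‖∞·e^{|λ₁|τ + K(t−t₀)} for all t > t₀. -/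
open Set

noncomputable section

/-- If every bound `‖g r‖ ≤ a e^{αr} + C e^{μr}` on `[0, ∞)` improves to a bound for the derivative
in which the contribution of `C` is contracted by `q < 1`, then exponential boundedness of `g` at
rate `μ` yields `‖g r‖ ≤ a e^{αr}`. -/
theorem norm_le_mul_exp_of_deriv_bound_improves {E : Type*} [NormedAddCommGroup E]
    [NormedSpace ℝ E] {g g' : ℝ → E} {a α μ q C₀ : ℝ} (hg : ∀ r, HasDerivAt g (g' r) r)
    (ha : ‖g 0‖ ≤ a) (hq₀ : 0 ≤ q) (hq₁ : q < 1) (hC₀ : 0 ≤ C₀)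
    (hgrowth : ∀ r, 0 ≤ r → ‖g r‖ ≤ C₀ * Real.exp (μ * r))
    (himprove : ∀ C, 0 ≤ C →
      (∀ r, 0 ≤ r → ‖g r‖ ≤ a * Real.exp (α * r) + C * Real.exp (μ * r)) →
      ∀ r, 0 ≤ r →
        ‖g' r‖ ≤ a * (α * Real.exp (α * r)) + q * C * (μ * Real.exp (μ * r))) :
    ∀ r, 0 ≤ r → ‖g r‖ ≤ a * Real.exp (α * r) := by
  have ha₀ : 0 ≤ a := (norm_nonneg _).trans ha
  have hexp (c x : ℝ) : HasDerivAt (fun r => Real.exp (c * r)) (c * Real.exp (c * x)) x := by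
    simpa [mul_comm] using ((hasDerivAt_id x).const_mul c).exp
  have hiter (n : ℕ) :
      ∀ r, 0 ≤ r → ‖g r‖ ≤ a * Real.exp (α * r) + q ^ n * C₀ * Real.exp (μ * r) := by
    induction n with
    | zero =>
      intro r hr
      have := hgrowth r hr
      have : 0 ≤ a * Real.exp (α * r) := by positivity
      rw [pow_zero, one_mul]
      linarith
    | succ n ih =>
      intro r hr
      have hC : 0 ≤ q ^ n * C₀ := by positivity
      have hqC : 0 ≤ q * (q ^ n * C₀) := by positivity
      rw [pow_succ', mul_assoc q]
      refine image_norm_le_of_norm_deriv_right_le_deriv_boundary (a := 0) (b := r)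
        (fun x _ => (hg x).continuousAt.continuousWithinAt)
        (fun x _ => (hg x).hasDerivWithinAt) ?_
        (fun x => ((hexp α x).const_mul a).add ((hexp μ x).const_mul (q * (q ^ n * C₀))))
        (fun x hx => himprove _ hC ih x hx.1) ⟨hr, le_rfl⟩
      simp only [Pi.add_apply, mul_zero, Real.exp_zero, mul_one]
      linarith
  intro r hr
  have hlim : Filter.Tendsto
      (fun n : ℕ => a * Real.exp (α * r) + q ^ n * C₀ * Real.exp (μ * r)) Filter.atTop
      (nhds (a * Real.exp (α * r))) := by
    simpa using (((tendsto_pow_atTop_nhds_zero_of_lt_one hq₀ hq₁).mul_const C₀).mul_const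
      (Real.exp (μ * r))).const_add (a * Real.exp (α * r))
  exact ge_of_tendsto' hlim fun n => hiter n r hr

theorem norm_seg_sub_seg_le {m : ℕ} {τ : ℝ} {y z : ℝ → Fin m → ℝ} (hy : Continuous y)
    (hz : Continuous z) {t B : ℝ} (hB : 0 ≤ B)
    (h : ∀ s ∈ Icc (t - τ) t, ‖y s - z s‖ ≤ B) : ‖seg τ y t - seg τ z t‖ ≤ B := by
  rw [ContinuousMap.norm_le _ hB]
  rintro ⟨s, hs₁, hs₂⟩
  simpa [seg, hy, hz] using h (t + s) ⟨by linarith, by linarith⟩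

theorem WeaklyNonlinear.norm_seg_sub_le {m : ℕ} {τ K A : ℝ} {F : ℝ → Hist τ m → Fin m → ℝ}
    (hF : WeaklyNonlinear τ F K A) (hK : 0 ≤ K) {y z : ℝ → Fin m → ℝ} (hy : Continuous y)
    (hz : Continuous z) {t B : ℝ} (hB : 0 ≤ B)
    (h : ∀ s ∈ Icc (t - τ) t, ‖y s - z s‖ ≤ B) :
    ‖F t (seg τ y t) - F t (seg τ z t)‖ ≤ K * B :=
  (hF.2.2 t _ _).trans (mul_le_mul_of_nonneg_left (norm_seg_sub_seg_le hy hz hB h) hK)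

theorem IsSpecialSol.exists_norm_le {m : ℕ} {τ : ℝ} (hτ : 0 < τ)
    {F : ℝ → Hist τ m → Fin m → ℝ} {y : ℝ → Fin m → ℝ} (hy : IsSpecialSol τ F y) (t₀ : ℝ) :
    ∃ C, 0 ≤ C ∧ ∀ t, ‖y t‖ ≤ C * Real.exp (1 / τ * |t - t₀|) := by
  obtain ⟨-, -, C, hC⟩ := hy
  have hC₀ : 0 ≤ C := le_trans (by positivity) (hC 0)
  refine ⟨C * Real.exp (1 / τ * |t₀|), by positivity, fun t => ?_⟩
  have h : ‖y t‖ ≤ C * Real.exp (1 / τ * |t|) := by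
    calc ‖y t‖ = Real.exp (-|t| / τ) * ‖y t‖ * Real.exp (1 / τ * |t|) := by
          rw [mul_right_comm, ← Real.exp_add, show -|t| / τ + 1 / τ * |t| = 0 by ring,
            Real.exp_zero, one_mul]
      _ ≤ _ := mul_le_mul_of_nonneg_right (hC t) (Real.exp_pos _).le
  refine h.trans ?_
  rw [mul_assoc, ← Real.exp_add, ← mul_add]
  gcongr
  have := abs_add_le t₀ (t - t₀)
  rwa [add_sub_cancel] at this

theorem IsSpecialSol.exists_norm_sub_le {m : ℕ} {τ : ℝ} (hτ : 0 < τ)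
    {F : ℝ → Hist τ m → Fin m → ℝ} {y z : ℝ → Fin m → ℝ} (hy : IsSpecialSol τ F y)
    (hz : IsSpecialSol τ F z) (t₀ : ℝ) :
    ∃ C, 0 ≤ C ∧ ∀ t, ‖y t - z t‖ ≤ C * Real.exp (1 / τ * |t - t₀|) := by
  obtain ⟨C, hC, hyC⟩ := hy.exists_norm_le hτ t₀
  obtain ⟨D, hD, hzD⟩ := hz.exists_norm_le hτ t₀
  refine ⟨C + D, by positivity, fun t => (norm_sub_le _ _).trans ?_⟩
  rw [add_mul]
  exact add_le_add (hyC t) (hzD t)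

theorem IsSpecialSol.norm_sub_le_backward {m : ℕ} {τ K A l : ℝ} (hτ : 0 < τ) (hK : 0 < K)
    (hsmall : K * τ * Real.exp 1 < 1) (hl : 0 < l) (hchar : l = K * Real.exp (l * τ))
    {F : ℝ → Hist τ m → Fin m → ℝ} (hF : WeaklyNonlinear τ F K A) {y z : ℝ → Fin m → ℝ}
    (hy : IsSpecialSol τ F y) (hz : IsSpecialSol τ F z) {t₀ t : ℝ} (ht : t ≤ t₀) :
    ‖y t - z t‖ ≤ ‖y t₀ - z t₀‖ * Real.exp (l * (t₀ - t)) := by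
  obtain ⟨C₀, hC₀, hgrowth⟩ := hy.exists_norm_sub_le hτ hz t₀
  have key := norm_le_mul_exp_of_deriv_bound_improves (g := fun r => y (t₀ - r) - z (t₀ - r))
    (a := ‖y t₀ - z t₀‖) (α := l) (μ := 1 / τ) (q := K * τ * Real.exp 1)
    (fun r => ((hy.2.1 (t₀ - r)).comp_const_sub t₀ r).sub ((hz.2.1 (t₀ - r)).comp_const_sub t₀ r))
    (by simp) (by positivity) hsmall hC₀
    (fun r hr => by simpa [abs_of_nonneg hr] using hgrowth (t₀ - r)) ?_ (t₀ - t) (by linarith)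
  · simpa using key
  intro C hC hbound r hr
  have hB := hF.norm_seg_sub_le hK.le hy.1 hz.1 (t := t₀ - r)
    (B := ‖y t₀ - z t₀‖ * Real.exp (l * (r + τ)) + C * Real.exp (1 / τ * (r + τ)))
    (by positivity) fun s hs => by
      have h := hbound (t₀ - s) (by linarith [hs.2])
      rw [sub_sub_cancel] at h
      have hsr : t₀ - s ≤ r + τ := by linarith [hs.1]
      exact h.trans (by gcongr)
  rw [← neg_add', norm_neg, ← sub_eq_add_neg]
  refine hB.trans_eq ?_
  have e1 : K * Real.exp (l * (r + τ)) = l * Real.exp (l * r) := by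
    rw [mul_add, Real.exp_add, mul_left_comm, ← hchar, mul_comm]
  have e2 : Real.exp (1 / τ * (r + τ)) = Real.exp 1 * Real.exp (1 / τ * r) := by
    rw [mul_add, one_div_mul_cancel hτ.ne', add_comm, Real.exp_add]
  rw [mul_add, mul_left_comm, e1, e2]
  field_simp

theorem IsSpecialSol.norm_sub_le_forward {m : ℕ} {τ K A l : ℝ} (hτ : 0 < τ) (hK : 0 < K)
    (hsmall : K * τ * Real.exp 1 < 1) (hl : 0 < l) (hchar : l = K * Real.exp (l * τ))
    {F : ℝ → Hist τ m → Fin m → ℝ} (hF : WeaklyNonlinear τ F K A) {y z : ℝ → Fin m → ℝ}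
    (hy : IsSpecialSol τ F y) (hz : IsSpecialSol τ F z) {t₀ t : ℝ} (ht : t₀ ≤ t) :
    ‖y t - z t‖ ≤ ‖y t₀ - z t₀‖ * Real.exp (l * τ + K * (t - t₀)) := by
  obtain ⟨C₀, hC₀, hgrowth⟩ := hy.exists_norm_sub_le hτ hz t₀
  have key := norm_le_mul_exp_of_deriv_bound_improves (g := fun r => y (t₀ + r) - z (t₀ + r))
    (a := ‖y t₀ - z t₀‖ * Real.exp (l * τ)) (α := K) (μ := 1 / τ) (q := K * τ * Real.exp 1)
    (fun r => ((hy.2.1 (t₀ + r)).comp_const_add t₀ r).sub ((hz.2.1 (t₀ + r)).comp_const_add t₀ r))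
    (by simpa using le_mul_of_one_le_right (norm_nonneg (y t₀ - z t₀))
          (Real.one_le_exp (by positivity : 0 ≤ l * τ)))
    (by positivity) hsmall hC₀
    (fun r hr => by simpa [abs_of_nonneg hr] using hgrowth (t₀ + r)) ?_ (t - t₀) (by linarith)
  · simpa [Real.exp_add, mul_assoc] using key
  intro C hC hbound r hr
  have hB := hF.norm_seg_sub_le hK.le hy.1 hz.1 (t := t₀ + r)
    (B := ‖y t₀ - z t₀‖ * Real.exp (l * τ) * Real.exp (K * r) + C * Real.exp (1 / τ * r))
    (by positivity) fun s hs => by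
      rcases le_total s t₀ with hs₀ | hs₀
      · have hsτ : t₀ - s ≤ τ := by linarith [hs.1]
        calc ‖y s - z s‖ ≤ ‖y t₀ - z t₀‖ * Real.exp (l * (t₀ - s)) :=
              hy.norm_sub_le_backward hτ hK hsmall hl hchar hF hz hs₀
          _ ≤ ‖y t₀ - z t₀‖ * Real.exp (l * τ) := by gcongr
          _ ≤ ‖y t₀ - z t₀‖ * Real.exp (l * τ) * Real.exp (K * r) :=
              le_mul_of_one_le_right (by positivity) (Real.one_le_exp (by positivity))
          _ ≤ _ := le_add_of_nonneg_right (by positivity)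
      · have h := hbound (s - t₀) (by linarith)
        rw [add_sub_cancel] at h
        have hsr : s - t₀ ≤ r := by linarith [hs.2]
        exact h.trans (by gcongr)
  refine hB.trans ?_
  rw [mul_add, mul_left_comm]
  have e : K * τ * Real.exp 1 * C * (1 / τ * Real.exp (1 / τ * r)) =
      K * (C * Real.exp (1 / τ * r)) * Real.exp 1 := by
    field_simp
  rw [e]
  exact add_le_add_right (le_mul_of_one_le_right (by positivity) (Real.one_le_exp zero_le_one)) _

theorem exists_eq_mul_exp_mem_Ioo {c : ℝ} (hc : 0 < c) (hc₁ : c * Real.exp 1 < 1) :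
    ∃ x ∈ Ioo (0 : ℝ) 1, x = c * Real.exp x := by
  obtain ⟨x, hx, h⟩ := intermediate_value_Ioo (zero_le_one (α := ℝ))
    (f := fun x => x - c * Real.exp x) (by fun_prop)
    (show (0 : ℝ) ∈ Ioo _ _ by simpa using ⟨hc, hc₁⟩)
  exact ⟨x, hx, sub_eq_zero.mp h⟩

theorem le_of_eq_mul_exp {c x y : ℝ} (hy₁ : y < 1) (hy₀ : 0 ≤ y) (hx : x = c * Real.exp x)
    (hy : y = c * Real.exp y) : y ≤ x := by
  by_contra! hlt
  have hxy : x = y * Real.exp (x - y) := by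
    calc x = c * Real.exp (y + (x - y)) := by rwa [add_sub_cancel]
      _ = y * Real.exp (x - y) := by rw [Real.exp_add, ← mul_assoc, ← hy]
  nlinarith [mul_le_mul_of_nonneg_left (Real.add_one_le_exp (x - y)) hy₀]

theorem eq_of_eq_mul_exp {c x y : ℝ} (hx₀ : x ∈ Ioo (0 : ℝ) 1) (hy₀ : y ∈ Ioo (0 : ℝ) 1)
    (hx : x = c * Real.exp x) (hy : y = c * Real.exp y) : x = y :=
  le_antisymm (le_of_eq_mul_exp hx₀.2 hx₀.1.le hy hx) (le_of_eq_mul_exp hy₀.2 hy₀.1.le hx hy)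

/-- The characteristic equation `λ = -K e^{-λτ}` has a unique solution `λ₁`
in `(-1/τ, 0)`, which satisfies `K < |λ₁| < K·e`; and any two special solutions of a DDE with
weakly nonlinear vector field (with Lipschitz constant `K`, `K·τ·e < 1`) through `(t₀,y₀)` and
`(t₀,z₀)` satisfy the stated exponential growth bounds backwards and forwards in time. -/
theorem characteristic_root_and_special_solution_bounds
    (τ K : ℝ) (hτ : 0 < τ) (hK : 0 < K) (hsmall : K * τ * Real.exp 1 < 1) :
    ∃ lambda1 : ℝ,
      (-(1/τ) < lambda1 ∧ lambda1 < 0 ∧ lambda1 = -K * Real.exp (-(lambda1 * τ))) ∧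
      (∀ μ : ℝ, -(1/τ) < μ → μ < 0 → μ = -K * Real.exp (-(μ * τ)) → μ = lambda1) ∧
      K < |lambda1| ∧ |lambda1| < K * Real.exp 1 ∧
      ∀ (m : ℕ) (F : ℝ → Hist τ m → Fin m → ℝ) (A : ℝ), 0 ≤ A →
        WeaklyNonlinear τ F K A →
        ∀ (t₀ : ℝ) (y₀ z₀ : Fin m → ℝ) (ybar zbar : ℝ → Fin m → ℝ),
          IsSpecialSol τ F ybar → ybar t₀ = y₀ →
          IsSpecialSol τ F zbar → zbar t₀ = z₀ →
          (∀ t : ℝ, t ≤ t₀ →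
            ‖ybar t - zbar t‖ ≤ ‖y₀ - z₀‖ * Real.exp (|lambda1| * (t₀ - t))) ∧
          (∀ t : ℝ, t₀ < t →
            ‖ybar t - zbar t‖ ≤ ‖y₀ - z₀‖ * Real.exp (|lambda1| * τ + K * (t - t₀))) := by
  obtain ⟨x, hx, hxe⟩ := exists_eq_mul_exp_mem_Ioo (mul_pos hK hτ) hsmall
  obtain ⟨l, rfl⟩ : ∃ l, x = l * τ := ⟨x / τ, by field_simp⟩
  have hl : 0 < l := pos_of_mul_pos_left hx.1 hτ.le
  have hchar : l = K * Real.exp (l * τ) :=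
    mul_right_cancel₀ hτ.ne' (hxe.trans (mul_right_comm _ _ _))
  refine ⟨-l, ⟨?_, by linarith, ?_⟩, ?_, ?_, ?_, ?_⟩
  · rw [neg_lt_neg_iff, lt_div_iff₀ hτ]
    exact hx.2
  · rw [neg_mul l, neg_neg, neg_mul, ← hchar]
  · intro μ hμ₁ hμ₀ hμ
    have hlt : -μ * τ < 1 := by
      rw [← lt_div_iff₀ hτ]
      linarith
    have h := eq_of_eq_mul_exp (c := K * τ) ⟨mul_pos (neg_pos.mpr hμ₀) hτ, hlt⟩ hx
      (by rw [mul_right_comm, neg_mul μ τ]; nlinarith [hμ]) hxe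
    rw [← mul_right_cancel₀ hτ.ne' h, neg_neg]
  · rw [abs_neg, abs_of_pos hl, hchar]
    exact lt_mul_of_one_lt_right hK (Real.one_lt_exp_iff.mpr hx.1)
  · rw [abs_neg, abs_of_pos hl, hchar]
    gcongr
    exact hx.2
  · rintro m F A - hF t₀ _ _ y z hy rfl hz rfl
    rw [abs_neg, abs_of_pos hl]
    exact ⟨fun t ht => hy.norm_sub_le_backward hτ hK hsmall hl hchar hF hz ht,
      fun t ht => hy.norm_sub_le_forward hτ hK hsmall hl hchar hF hz ht.le⟩
end
end

section
/- Let X ⊆ ℝⁿ be open, and let Ψ_i ∈ C³(X, ℝ) have a non-degenerate local minimum p ∈ X with radius of definition r₀ > 0, realized by a C¹-diffeomorphism μ : U → μ(U) ⊆ X with μ(0) = p and Ψ_i(μ(u)) = Ψ_i(p) + ‖u‖₂² on U ⊇ K̄_{r₀}(0). Set 𝒦₀ := μ(K̄_{r₀}(0)) and let λ : ℝⁿ → ℝᵐ, λ(x) = Wx + b, be an affine map with W ∈ ℝ^{m×n}. If rank(W) < n, then there exists a point s ∈ ∂𝒦₀ on the boundary of 𝒦₀ with λ(s) = λ(p). 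-/
open Set

noncomputable section

/-- `μ`, `ν` form a `C¹`-diffeomorphism from the open set `U` onto the open set `μ '' U`. -/
def IsC1DiffeoOn {n : ℕ} (μ ν : (Fin n → ℝ) → Fin n → ℝ) (U : Set (Fin n → ℝ)) : Prop :=
  IsOpen U ∧ IsOpen (μ '' U) ∧ ContDiffOn ℝ 1 μ U ∧ ContDiffOn ℝ 1 ν (μ '' U) ∧
    (∀ u ∈ U, ν (μ u) = u) ∧ (∀ v ∈ μ '' U, μ (ν v) = v)

/-- A matrix whose rank is smaller than its number of columns has a nonzero kernel vector. -/
theorem exists_ne_zero_mulVec_eq_zero_of_rank_lt {n m : ℕ} (W : Matrix (Fin m) (Fin n) ℝ)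
    (hrank : W.rank < n) : ∃ v : Fin n → ℝ, v ≠ 0 ∧ W.mulVec v = 0 := by
  by_contra! h
  have hinj : Function.Injective W.mulVecLin := by
    rw [injective_iff_map_eq_zero]
    intro v hv
    by_contra hne
    exact h v hne hv
  have hfin := LinearMap.finrank_range_of_inj hinj
  rw [Module.finrank_fin_fun] at hfin
  exact hrank.ne hfin

theorem isCompact_setOf_sum_sq_le {n : ℕ} (r : ℝ) :
    IsCompact {u : Fin n → ℝ | ∑ i, u i ^ 2 ≤ r ^ 2} := by
  refine Metric.isCompact_of_isClosed_isBounded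
    (isClosed_le (by fun_prop) continuous_const) ?_
  refine (Metric.isBounded_closedBall (x := 0) (r := |r|)).subset fun u hu => ?_
  rw [mem_closedBall_zero_iff, pi_norm_le_iff_of_nonneg (abs_nonneg r)]
  intro i
  rw [Real.norm_eq_abs, ← sq_le_sq]
  exact (Finset.single_le_sum (f := fun j => u j ^ 2) (fun j _ => sq_nonneg (u j))
    (Finset.mem_univ i)).trans hu

/-- A line through a point of a bounded set meets the frontier of that set. -/
theorem exists_add_smul_mem_frontier {E : Type*} [NormedAddCommGroup E] [NormedSpace ℝ E]
    {K : Set E} (hK : Bornology.IsBounded K) {p v : E} (hp : p ∈ K) (hv : v ≠ 0) :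
    ∃ t : ℝ, p + t • v ∈ frontier K := by
  have hline : Continuous fun t : ℝ => p + t • v := by fun_prop
  obtain ⟨R, hR⟩ := hK.exists_norm_le
  have hv' : 0 < ‖v‖ := norm_pos_iff.mpr hv
  have hout : p + ((R + ‖p‖ + 1) / ‖v‖) • v ∉ K := by
    intro hmem
    have hle := norm_sub_le (p + ((R + ‖p‖ + 1) / ‖v‖) • v) p
    rw [add_sub_cancel_left, norm_smul, Real.norm_eq_abs] at hle
    have habs := mul_le_mul_of_nonneg_right (le_abs_self ((R + ‖p‖ + 1) / ‖v‖)) hv'.le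
    rw [div_mul_cancel₀ _ hv'.ne'] at habs
    linarith [hR _ hmem]
  obtain ⟨t, ht⟩ : (frontier ((fun t : ℝ => p + t • v) ⁻¹' K)).Nonempty :=
    nonempty_frontier_iff.mpr ⟨⟨0, by simpa using hp⟩, fun h => hout (eq_univ_iff_forall.mp h _)⟩
  exact ⟨t, hline.frontier_preimage_subset K ht⟩

/-- If the weight matrix `W` of the affine map `λ(x) = Wx + b` has
`rank W < n`, then there is a boundary point `s ∈ ∂𝒦₀` of `𝒦₀ = μ(K̄_{r₀}(0))` with
`λ(s) = λ(p)`. -/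
theorem rank_deficient_boundary_collapse
    {n m : ℕ} (X : Set (Fin n → ℝ)) (hX : IsOpen X)
    (Ψi : (Fin n → ℝ) → ℝ) (hΨi : ContDiffOn ℝ 3 Ψi X)
    (p : Fin n → ℝ) (r₀ : ℝ) (hr₀ : 0 < r₀)
    (U : Set (Fin n → ℝ)) (μ ν : (Fin n → ℝ) → Fin n → ℝ)
    (hdiffeo : IsC1DiffeoOn μ ν U)
    (hball : {u : Fin n → ℝ | ∑ i, u i ^ 2 ≤ r₀ ^ 2} ⊆ U)
    (hsub : μ '' U ⊆ X) (hp : μ 0 = p)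
    (hmin : ∀ u ∈ U, Ψi (μ u) = Ψi p + ∑ i, u i ^ 2)
    (W : Matrix (Fin m) (Fin n) ℝ) (b : Fin m → ℝ) (hrank : W.rank < n) :
    ∃ s ∈ frontier (μ '' {u : Fin n → ℝ | ∑ i, u i ^ 2 ≤ r₀ ^ 2}),
      W.mulVec s + b = W.mulVec p + b := by
  obtain ⟨v, hv, hWv⟩ := exists_ne_zero_mulVec_eq_zero_of_rank_lt W hrank
  have hK : IsCompact (μ '' {u : Fin n → ℝ | ∑ i, u i ^ 2 ≤ r₀ ^ 2}) :=
    (isCompact_setOf_sum_sq_le r₀).image_of_continuousOn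
      (hdiffeo.2.2.1.continuousOn.mono hball)
  have hpK : p ∈ μ '' {u : Fin n → ℝ | ∑ i, u i ^ 2 ≤ r₀ ^ 2} :=
    ⟨0, by simp [sq_nonneg], hp⟩
  obtain ⟨t, ht⟩ := exists_add_smul_mem_frontier hK.isBounded hpK hv
  exact ⟨_, ht, by rw [Matrix.mulVec_add, Matrix.mulVec_smul, hWv, smul_zero, add_zero]⟩
end
end
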